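/- Let Ψ be a smooth function on the open ball B(0,R₀) in ℝ^d satisfying ΔΨ = σΨ for some real constant σ, where Δ is the Euclidean Laplacian. Let β be a bounded measurable rotationally invariant function on B(0,R₀). Then for all 0 < R < R₀, ∫_{|Y|≤R} Ψ(Y)β(Y) dY = Ψ(0)·∫_{|Y|≤R} e^{√σ · y₁} β(Y) dY, where √σ is either square root of σ (interpreted in ℂ when σ < 0) and Y = (y₁,…,y_d). -/

import Mathlib

open MeasureTheory Metric

/-- The Euclidean Laplacian of a function on `ℝ^d`, as the sum of the pure second
partial derivatives in the coordinate directions. -/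
noncomputable def euclLaplacian {d : ℕ} (Ψ : EuclideanSpace ℝ (Fin d) → ℂ)
    (x : EuclideanSpace ℝ (Fin d)) : ℂ :=
  ∑ i : Fin d, iteratedFDeriv ℝ 2 Ψ x (fun _ => EuclideanSpace.single i 1)


namespace EigBall

/-- the radial antiderivative vanishing beyond `Q` -/
noncomputable def anti (Q : ℝ) (w : ℝ → ℝ) (t : ℝ) : ℝ := ∫ u in Q..t, w u

lemma anti_hasDerivAt {Q : ℝ} {w : ℝ → ℝ} (hw : Continuous w) (t : ℝ) :
    HasDerivAt (anti Q w) (w t) t :=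
  intervalIntegral.integral_hasDerivAt_right (hw.intervalIntegrable _ _)
    (hw.stronglyMeasurableAtFilter _ _) hw.continuousAt

lemma anti_continuous {Q : ℝ} {w : ℝ → ℝ} (hw : Continuous w) : Continuous (anti Q w) :=
  continuous_iff_continuousAt.2 fun t => (anti_hasDerivAt hw t).continuousAt

lemma anti_zero {Q : ℝ} {w : ℝ → ℝ} (hw0 : ∀ t, Q ≤ t → w t = 0) (t : ℝ) (ht : Q ≤ t) :
    anti Q w t = 0 := by
  unfold anti
  rw [intervalIntegral.integral_congr (g := fun _ => (0 : ℝ))]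
  · simp
  · intro u hu
    rw [Set.uIcc_of_le ht] at hu
    exact hw0 u hu.1

lemma anti_bound {Q c : ℝ} {w : ℝ → ℝ} (hc : ∀ t, 0 ≤ t → |w t| ≤ c)
    (hw0 : ∀ t, Q ≤ t → w t = 0) (hQ : 0 ≤ Q) (hc0 : 0 ≤ c) (t : ℝ) (ht : 0 ≤ t) :
    |anti Q w t| ≤ c * Q := by
  rcases le_total Q t with h | h
  · rw [anti_zero hw0 t h]; simp; positivity
  · have := intervalIntegral.norm_integral_le_of_norm_le_const (a := Q) (b := t) (f := w) (C := c)
      (by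
        intro x hx
        rw [Set.uIoc_of_ge h] at hx
        exact hc x (ht.trans hx.1.le))
    unfold anti
    rw [Real.norm_eq_abs] at this
    refine this.trans ?_
    gcongr
    rw [abs_sub_comm, abs_of_nonneg (by linarith)]; linarith

variable {d : ℕ}

lemma radial_compact {F : Type*} [NormedAddCommGroup F] {Q : ℝ}
    (f : EuclideanSpace ℝ (Fin d) → F) (hf : ∀ x, Q ≤ ‖x‖ ^ 2 → f x = 0) :
    HasCompactSupport f := by
  apply HasCompactSupport.intro (isCompact_closedBall (0 : EuclideanSpace ℝ (Fin d)) (|Q| + 1))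
  intro x hx
  apply hf
  rw [mem_closedBall_zero_iff, not_le] at hx
  have := le_abs_self Q
  have := abs_nonneg Q
  nlinarith

lemma radial_hasFDerivAt {Q : ℝ} {w : ℝ → ℝ} (hw : Continuous w)
    (x : EuclideanSpace ℝ (Fin d)) :
    HasFDerivAt (fun x : EuclideanSpace ℝ (Fin d) => anti Q w (‖x‖ ^ 2))
      (w (‖x‖ ^ 2) • (2 • innerSL ℝ x)) x :=
  (anti_hasDerivAt hw _).comp_hasFDerivAt x (hasStrictFDerivAt_norm_sq x).hasFDerivAt

/-- integration by parts in one direction -/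
lemma ibp {Q : ℝ} {w : ℝ → ℝ} (hw : Continuous w) (hw0 : ∀ t, Q ≤ t → w t = 0)
    {G : EuclideanSpace ℝ (Fin d) → ℂ} (hG : ContDiff ℝ 1 G)
    (v : EuclideanSpace ℝ (Fin d)) (r : ℝ) :
    ∫ x : EuclideanSpace ℝ (Fin d), (w (‖x‖ ^ 2) * inner ℝ x v) • G (r • x)
      = - (r / 2 : ℝ) • ∫ x : EuclideanSpace ℝ (Fin d),
          anti Q w (‖x‖ ^ 2) • (fderiv ℝ G (r • x) v) := by
  have hGr : ∀ x, HasFDerivAt (fun x : EuclideanSpace ℝ (Fin d) => G (r • x))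
      (r • fderiv ℝ G (r • x)) x := by
    intro x
    have h1 := (hG.differentiable (by simp) (r • x)).hasFDerivAt
    have h2 : HasFDerivAt (fun x : EuclideanSpace ℝ (Fin d) => r • x)
      (r • ContinuousLinearMap.id ℝ (EuclideanSpace ℝ (Fin d))) x :=
      (hasFDerivAt_id x).const_smul r
    have := h1.comp x h2
    refine this.congr_fderiv ?_
    ext; simp
  have hcG := hG.continuous
  have hcdG : Continuous (fderiv ℝ G) := hG.continuous_fderiv (by simp)
  have hca := anti_continuous (Q := Q) hw
  have key := integral_bilinear_hasFDerivAt_right_eq_neg_left_of_integrable (μ := volume)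
    (f := fun x : EuclideanSpace ℝ (Fin d) => anti Q w (‖x‖ ^ 2))
    (f' := fun x => w (‖x‖ ^ 2) • (2 • innerSL ℝ x))
    (g := fun x => G (r • x)) (g' := fun x => r • fderiv ℝ G (r • x)) (v := v)
    (B := ContinuousLinearMap.lsmul ℝ ℝ) ?_ ?_ ?_
    (fun x _ => radial_hasFDerivAt hw x) (fun x _ => hGr x)
  · simp only [ContinuousLinearMap.lsmul_apply, smul_apply,
      innerSL_apply_apply] at key
    have e1 : ∀ x : EuclideanSpace ℝ (Fin d), anti Q w (‖x‖ ^ 2) • r • fderiv ℝ G (r • x) v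
      = r • (anti Q w (‖x‖ ^ 2) • fderiv ℝ G (r • x) v) := fun x => smul_comm _ _ _
    have e2 : ∀ x : EuclideanSpace ℝ (Fin d), (w (‖x‖ ^ 2) • (2 • inner ℝ x v)) • G (r • x)
      = (2 : ℝ) • ((w (‖x‖ ^ 2) * inner ℝ x v) • G (r • x)) := by
      intro x
      rw [smul_smul]; congr 1; simp; ring
    simp only [e1, e2] at key
    rw [integral_smul, integral_smul] at key
    have : (2 : ℝ) • ∫ x : EuclideanSpace ℝ (Fin d), (w (‖x‖ ^ 2) * inner ℝ x v) • G (r • x)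
      = - (r • ∫ x : EuclideanSpace ℝ (Fin d),
          anti Q w (‖x‖ ^ 2) • (fderiv ℝ G (r • x) v)) := by rw [key, neg_neg]
    rw [← smul_right_inj (two_ne_zero (α := ℝ)), this, smul_smul, ← neg_smul]
    congr 1; ring
  · refine Continuous.integrable_of_hasCompactSupport ?_ (radial_compact (Q := Q) _ ?_)
    · simp only [ContinuousLinearMap.lsmul_apply, smul_apply,
        innerSL_apply_apply]
      fun_prop
    · intro x hx; simp [hw0 _ hx]
  · refine Continuous.integrable_of_hasCompactSupport ?_ (radial_compact (Q := Q) _ ?_)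
    · simp only [ContinuousLinearMap.lsmul_apply, smul_apply]
      fun_prop
    · intro x hx; simp [anti_zero hw0 _ hx]
  · refine Continuous.integrable_of_hasCompactSupport ?_ (radial_compact (Q := Q) _ ?_)
    · simp only [ContinuousLinearMap.lsmul_apply]
      fun_prop
    · intro x hx; simp [anti_zero hw0 _ hx]

/-- the radial functional -/
noncomputable def A (Φ : EuclideanSpace ℝ (Fin d) → ℂ) (w : ℝ → ℝ) (r : ℝ) : ℂ :=
  ∫ x : EuclideanSpace ℝ (Fin d), w (‖x‖ ^ 2) • Φ (r • x)

lemma A_hasDerivAt_aux {Q : ℝ} {w : ℝ → ℝ} (hw : Continuous w) (hw0 : ∀ t, Q ≤ t → w t = 0)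
    {Φ : EuclideanSpace ℝ (Fin d) → ℂ} (hΦ : ContDiff ℝ 2 Φ) (hΦc : HasCompactSupport Φ)
    (r : ℝ) :
    HasDerivAt (A Φ w) (∫ x : EuclideanSpace ℝ (Fin d), w (‖x‖ ^ 2) • fderiv ℝ Φ (r • x) x) r := by
  have hcd : Continuous (fderiv ℝ Φ) := hΦ.continuous_fderiv (by simp)
  have hc := hΦ.continuous
  obtain ⟨K, hK⟩ := (hΦc.fderiv (𝕜 := ℝ)).exists_bound_of_continuous hcd
  refine (hasDerivAt_integral_of_dominated_loc_of_deriv_le (s := Set.univ)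
    (F := fun (r : ℝ) (x : EuclideanSpace ℝ (Fin d)) => w (‖x‖ ^ 2) • Φ (r • x))
    (F' := fun (r : ℝ) (x : EuclideanSpace ℝ (Fin d)) => w (‖x‖ ^ 2) • fderiv ℝ Φ (r • x) x)
    (bound := fun x => |w (‖x‖ ^ 2)| * (K * ‖x‖))
    Filter.univ_mem ?_ ?_ ?_ ?_ ?_ ?_).2
  · refine Filter.Eventually.of_forall fun r => Continuous.aestronglyMeasurable ?_
    fun_prop
  · refine Continuous.integrable_of_hasCompactSupport ?_ (radial_compact (Q := Q) _ ?_)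
    · fun_prop
    · intro x hx; simp [hw0 _ hx]
  · refine Continuous.aestronglyMeasurable ?_
    fun_prop
  · refine Filter.Eventually.of_forall fun x r _ => ?_
    rw [norm_smul, Real.norm_eq_abs]
    gcongr
    refine (ContinuousLinearMap.le_opNorm _ _).trans ?_
    gcongr
    exact hK _
  · refine Continuous.integrable_of_hasCompactSupport ?_ (radial_compact (Q := Q) _ ?_)
    · fun_prop
    · intro x hx; simp [hw0 _ hx]
  · refine Filter.Eventually.of_forall fun x r _ => ?_
    have h1 := (hΦ.differentiable (by simp) (r • x)).hasFDerivAt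
    have h2 : HasDerivAt (fun r : ℝ => r • x) x r := by
      simpa using (hasDerivAt_id r).smul_const x
    exact (h1.comp_hasDerivAt r h2).const_smul (w (‖x‖ ^ 2))

lemma A_hasDerivAt {Q σ : ℝ} {w : ℝ → ℝ} (hw : Continuous w) (hw0 : ∀ t, Q ≤ t → w t = 0)
    {Φ : EuclideanSpace ℝ (Fin d) → ℂ} (hΦ : ContDiff ℝ 2 Φ) (hΦc : HasCompactSupport Φ)
    (heig : ∀ x, ‖x‖ ^ 2 < Q → euclLaplacian Φ x = (σ : ℂ) * Φ x)
    (r : ℝ) (hr0 : 0 ≤ r) (hr1 : r ≤ 1) :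
    HasDerivAt (A Φ w) (- (r / 2 * σ : ℝ) • A Φ (anti Q w) r) r := by
  convert A_hasDerivAt_aux hw hw0 hΦ hΦc r using 1
  have hcd : Continuous (fderiv ℝ Φ) := hΦ.continuous_fderiv (by simp)
  have hca := anti_continuous (Q := Q) hw
  let e : Fin d → EuclideanSpace ℝ (Fin d) := fun i => EuclideanSpace.single i 1
  let G : Fin d → EuclideanSpace ℝ (Fin d) → ℂ := fun i y => fderiv ℝ Φ y (e i)
  have hG : ∀ i, ContDiff ℝ 1 (G i) := fun i =>
    (hΦ.fderiv_right (m := 1) (by norm_num)).clm_apply contDiff_const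
  have hx : ∀ x : EuclideanSpace ℝ (Fin d), w (‖x‖ ^ 2) • fderiv ℝ Φ (r • x) x
      = ∑ i, (w (‖x‖ ^ 2) * inner ℝ x (e i)) • G i (r • x) := by
    intro x
    have : x = ∑ i, x i • e i := by
      simpa [e] using ((EuclideanSpace.basisFun (Fin d) ℝ).sum_repr x).symm
    conv_lhs => rw [this, map_sum, ← this]
    rw [Finset.smul_sum]
    refine Finset.sum_congr rfl fun i _ => ?_
    rw [map_smul, smul_smul]
    congr 2
    simp [e, EuclideanSpace.inner_single_right]
  have hlap : ∀ y, euclLaplacian Φ y = ∑ i, fderiv ℝ (G i) y (e i) := by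
    intro y
    unfold euclLaplacian
    refine Finset.sum_congr rfl fun i _ => ?_
    rw [iteratedFDeriv_two_apply]
    have hd : DifferentiableAt ℝ (fderiv ℝ Φ) y :=
      (hΦ.fderiv_right (m := 1) (by norm_num)).differentiable (by simp) y
    simp only [G]
    rw [fderiv_clm_apply hd (differentiableAt_const _)]
    simp [e]
  simp_rw [hx]
  rw [integral_finsetSum]
  · simp_rw [fun i => ibp hw hw0 (hG i) (e i) r]
    rw [← Finset.smul_sum, ← integral_finsetSum]
    · unfold A
      rw [neg_smul, neg_smul, mul_smul, ← integral_smul]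
      congr 2
      refine integral_congr_ae (Filter.Eventually.of_forall fun x => ?_)
      simp only
      rw [← Finset.smul_sum, ← hlap]
      rcases le_or_gt Q (‖x‖ ^ 2) with h | h
      · simp [anti_zero hw0 _ h]
      · rw [heig]
        · simp only [Complex.real_smul]; ring
        · rw [norm_smul, Real.norm_eq_abs, abs_of_nonneg hr0]
          have : r * ‖x‖ ≤ ‖x‖ := mul_le_of_le_one_left (norm_nonneg _) hr1
          have : 0 ≤ r * ‖x‖ := by positivity
          nlinarith
    · intro i _
      have := (hG i).continuous_fderiv (by simp)
      refine Continuous.integrable_of_hasCompactSupport ?_ (radial_compact (Q := Q) _ ?_)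
      · fun_prop
      · intro x hx; simp [anti_zero hw0 _ hx]
  · intro i _
    have := (hG i).continuous
    refine Continuous.integrable_of_hasCompactSupport ?_ (radial_compact (Q := Q) _ ?_)
    · fun_prop
    · intro x hx; simp [hw0 _ hx]

lemma A_bound {Q σ : ℝ} (hQ : 0 ≤ Q)
    {Φ : EuclideanSpace ℝ (Fin d) → ℂ} (hΦ : ContDiff ℝ 2 Φ) (hΦc : HasCompactSupport Φ)
    (heig : ∀ x, ‖x‖ ^ 2 < Q → euclLaplacian Φ x = (σ : ℂ) * Φ x) (hΦ0 : Φ 0 = 0) :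
    ∃ V : ℝ, 0 ≤ V ∧ ∀ n : ℕ, ∀ (w : ℝ → ℝ) (c : ℝ), Continuous w → (∀ t, Q ≤ t → w t = 0) →
      (∀ t, 0 ≤ t → |w t| ≤ c) → ∀ r ∈ Set.Icc (0 : ℝ) 1,
      ‖A Φ w r‖ ≤ c * V * (|σ| * Q / 4) ^ n / n.factorial * r ^ (2 * n) := by
  obtain ⟨K, hK⟩ := hΦc.exists_bound_of_continuous hΦ.continuous
  have hK0 : 0 ≤ K := (norm_nonneg _).trans (hK 0)
  refine ⟨K * volume.real (closedBall (0 : EuclideanSpace ℝ (Fin d)) (Real.sqrt Q)),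
    by positivity, ?_⟩
  set V := K * volume.real (closedBall (0 : EuclideanSpace ℝ (Fin d)) (Real.sqrt Q)) with hV
  have hV0 : 0 ≤ V := by positivity
  intro n
  induction n with
  | zero =>
    intro w c hw hw0 hc r hr
    have hc0 : 0 ≤ c := (abs_nonneg _).trans (hc 0 le_rfl)
    have : A Φ w r = ∫ x in closedBall (0 : EuclideanSpace ℝ (Fin d)) (Real.sqrt Q),
        w (‖x‖ ^ 2) • Φ (r • x) := by
      unfold A
      rw [setIntegral_eq_integral_of_forall_compl_eq_zero]
      intro x hx
      rw [mem_closedBall_zero_iff, not_le] at hx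
      rw [hw0, zero_smul]
      exact (Real.lt_sq_of_sqrt_lt hx).le
    rw [this]
    have := norm_setIntegral_le_of_norm_le_const (μ := volume) (C := c * K)
      (f := fun x : EuclideanSpace ℝ (Fin d) => w (‖x‖ ^ 2) • Φ (r • x))
      (s := closedBall (0 : EuclideanSpace ℝ (Fin d)) (Real.sqrt Q)) measure_closedBall_lt_top
      (by
        intro x _
        rw [norm_smul, Real.norm_eq_abs]
        gcongr
        · exact hc _ (by positivity)
        · exact hK _)
    refine this.trans (le_of_eq ?_)
    simp [hV]; ring
  | succ n ih =>
    intro w c hw hw0 hc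
    have hc0 : 0 ≤ c := (abs_nonneg _).trans (hc 0 le_rfl)
    have ih' := ih (anti Q w) (c * Q) (anti_continuous hw) (anti_zero hw0)
      (anti_bound hc hw0 hQ hc0)
    have hder := fun r hr0 hr1 => A_hasDerivAt hw hw0 hΦ hΦc heig r hr0 hr1
    intro r hr
    refine image_norm_le_of_norm_deriv_right_le_deriv_boundary (a := 0) (b := 1)
      (f := A Φ w) (f' := fun r => - (r / 2 * σ : ℝ) • A Φ (anti Q w) r)
      (B := fun r => c * V * (|σ| * Q / 4) ^ (n+1) / (n+1).factorial * r ^ (2 * (n+1)))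
      (B' := fun r => c * V * (|σ| * Q / 4) ^ (n+1) / (n+1).factorial *
        ((2 * (n+1) : ℕ) * r ^ (2 * (n+1) - 1)))
      ?_ ?_ ?_ ?_ ?_ hr
    · intro x hx
      exact (hder x hx.1 hx.2).continuousAt.continuousWithinAt
    · intro x hx
      exact (hder x hx.1 hx.2.le).hasDerivWithinAt
    · have : A Φ w 0 = 0 := by simp [A, hΦ0]
      simp [this]
    · intro x
      exact (hasDerivAt_pow _ x).const_mul _
    · intro x hx
      rw [norm_smul, norm_neg, Real.norm_eq_abs, abs_mul, abs_of_nonneg (by linarith [hx.1])]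
      have h1 := ih' x ⟨hx.1, hx.2.le⟩
      have hx0 := hx.1
      calc _ ≤ x / 2 * |σ| * (c * Q * V * (|σ| * Q / 4) ^ n / n.factorial * x ^ (2 * n)) := by
            gcongr
        _ = _ := by
            rw [Nat.factorial_succ, show 2 * (n+1) - 1 = 2 * n + 1 by omega]
            push_cast
            have : (n.factorial : ℝ) ≠ 0 := by positivity
            field_simp
            ring

lemma A_eq_zero {Q σ : ℝ} (hQ : 0 ≤ Q)
    {Φ : EuclideanSpace ℝ (Fin d) → ℂ} (hΦ : ContDiff ℝ 2 Φ) (hΦc : HasCompactSupport Φ)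
    (heig : ∀ x, ‖x‖ ^ 2 < Q → euclLaplacian Φ x = (σ : ℂ) * Φ x) (hΦ0 : Φ 0 = 0)
    {w : ℝ → ℝ} (hw : Continuous w) (hw0 : ∀ t, Q ≤ t → w t = 0) :
    ∫ x : EuclideanSpace ℝ (Fin d), w (‖x‖ ^ 2) • Φ x = 0 := by
  obtain ⟨V, hV, h⟩ := A_bound hQ hΦ hΦc heig hΦ0
  obtain ⟨c, hc⟩ := (isCompact_Icc (a := (0:ℝ)) (b := Q)).exists_bound_of_continuousOn
    hw.continuousOn
  have hc0 : 0 ≤ c := (norm_nonneg _).trans (hc 0 ⟨le_rfl, hQ⟩)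
  have hc' : ∀ t, 0 ≤ t → |w t| ≤ c := by
    intro t ht
    rcases le_total Q t with h | h
    · simpa [hw0 t h]
    · exact hc t ⟨ht, h⟩
  have hb : ∀ n : ℕ, ‖A Φ w 1‖ ≤ c * V * ((|σ| * Q / 4) ^ n / n.factorial) := by
    intro n
    have := h n w c hw hw0 hc' 1 ⟨zero_le_one, le_rfl⟩
    simpa [mul_div_assoc] using this
  have hlim : Filter.Tendsto (fun n : ℕ => c * V * ((|σ| * Q / 4) ^ n / n.factorial))
      Filter.atTop (nhds 0) := by
    simpa using (FloorSemiring.tendsto_pow_div_factorial_atTop (|σ| * Q / 4)).const_mul (c * V)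
  have := ge_of_tendsto' hlim hb
  have h0 : A Φ w 1 = 0 := norm_le_zero_iff.1 this
  simpa [A] using h0

lemma measurable_radial {R Q σ : ℝ} (hR : 0 < R) (hQ : R ^ 2 < Q)
    {Φ : EuclideanSpace ℝ (Fin d) → ℂ} (hΦ : ContDiff ℝ 2 Φ) (hΦc : HasCompactSupport Φ)
    (heig : ∀ x, ‖x‖ ^ 2 < Q → euclLaplacian Φ x = (σ : ℂ) * Φ x) (hΦ0 : Φ 0 = 0)
    {b : ℝ → ℝ} (hb : Measurable b) {C : ℝ} (hC : ∀ t, |b t| ≤ C) :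
    ∫ x in closedBall (0 : EuclideanSpace ℝ (Fin d)) R, b (‖x‖ ^ 2) • Φ x = 0 := by
  obtain ⟨K, hK⟩ := hΦc.exists_bound_of_continuous hΦ.continuous
  have hK0 : 0 ≤ K := (norm_nonneg _).trans (hK 0)
  have hR2 : 0 < R ^ 2 := by positivity
  have hQ0 : 0 < Q := hR2.trans hQ
  set S := closedBall (0 : EuclideanSpace ℝ (Fin d)) (Real.sqrt Q) with hS
  let ν : Measure (EuclideanSpace ℝ (Fin d)) := volume.restrict S
  have : IsFiniteMeasure ν := ⟨by
    simpa [ν] using (measure_closedBall_lt_top : volume S < ⊤)⟩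
  let N : EuclideanSpace ℝ (Fin d) → ℝ := fun x => ‖x‖ ^ 2
  have hN : Measurable N := by fun_prop
  let μ : Measure ℝ := ν.map N
  let b1 : ℝ → ℝ := (Set.Iic (R ^ 2)).indicator b
  have hb1 : Measurable b1 := hb.indicator measurableSet_Iic
  have hb1b : ∀ t, ‖b1 t‖ ≤ C := fun t => (norm_indicator_le_norm_self _ _).trans (hC t)
  have hb1i : Integrable b1 μ := Integrable.of_bound hb1.aestronglyMeasurable C
    (Filter.Eventually.of_forall hb1b)
  have e0 : ∫ x in closedBall (0 : EuclideanSpace ℝ (Fin d)) R, b (‖x‖ ^ 2) • Φ x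
      = ∫ x, b1 (N x) • Φ x ∂ν := by
    have : ∀ x, b1 (N x) • Φ x = (closedBall (0 : EuclideanSpace ℝ (Fin d)) R).indicator
        (fun x => b (‖x‖ ^ 2) • Φ x) x := by
      intro x
      by_cases hx : x ∈ closedBall (0 : EuclideanSpace ℝ (Fin d)) R
      · rw [Set.indicator_of_mem hx]
        rw [mem_closedBall_zero_iff] at hx
        simp only [b1, N]
        rw [Set.indicator_of_mem]
        simp only [Set.mem_Iic]
        gcongr
      · rw [Set.indicator_of_notMem hx]
        rw [mem_closedBall_zero_iff, not_le] at hx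
        simp only [b1, N]
        rw [Set.indicator_of_notMem, zero_smul]
        simp only [Set.mem_Iic, not_le]
        gcongr
    simp_rw [this]
    rw [integral_indicator measurableSet_closedBall, Measure.restrict_restrict
      measurableSet_closedBall, Set.inter_eq_left.2]
    exact closedBall_subset_closedBall (Real.le_sqrt_of_sq_le hQ.le)
  rw [e0]
  have hest : ∀ ε > 0, ‖∫ x, b1 (N x) • Φ x ∂ν‖ ≤ ε * K := by
    intro ε hε
    obtain ⟨g, hg, hgi⟩ := hb1i.exists_boundedContinuous_integral_sub_le hε
    -- cutoff
    let χ : ℝ → ℝ := fun t => max 0 (min 1 ((Q - t) / (Q - R ^ 2)))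
    have hχc : Continuous χ := by fun_prop
    have hQR : 0 < Q - R ^ 2 := by linarith
    have hχ0 : ∀ t, Q ≤ t → χ t = 0 := by
      intro t ht
      apply max_eq_left
      exact (min_le_right _ _).trans (div_nonpos_of_nonpos_of_nonneg (by linarith) hQR.le)
    have hχ1 : ∀ t, t ≤ R ^ 2 → χ t = 1 := by
      intro t ht
      have : 1 ≤ (Q - t) / (Q - R ^ 2) := by rw [le_div_iff₀ hQR]; linarith
      simp [χ, min_eq_left this]
    have hχn : ∀ t, 0 ≤ χ t := fun t => le_max_left _ _
    have hχl : ∀ t, χ t ≤ 1 := fun t => max_le zero_le_one (min_le_left _ _)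
    let w : ℝ → ℝ := fun t => χ t * g t
    have hw : Continuous w := hχc.mul g.continuous
    have hw0 : ∀ t, Q ≤ t → w t = 0 := fun t ht => by simp [w, hχ0 t ht]
    have hA := A_eq_zero hQ0.le hΦ hΦc heig hΦ0 hw hw0
    have hA' : ∫ x, w (N x) • Φ x ∂ν = 0 := by
      rw [← hA]
      apply setIntegral_eq_integral_of_forall_compl_eq_zero
      intro x hx
      rw [hS, mem_closedBall_zero_iff, not_le] at hx
      rw [hw0, zero_smul]
      exact (Real.lt_sq_of_sqrt_lt hx).le
    have hdiff : ∀ t, ‖b1 t - w t‖ ≤ ‖b1 t - g t‖ := by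
      intro t
      have : b1 t - w t = χ t * (b1 t - g t) := by
        simp only [w, b1]
        by_cases ht : t ∈ Set.Iic (R ^ 2)
        · rw [hχ1 t ht]; ring
        · rw [Set.indicator_of_notMem ht]; ring
      rw [this, norm_mul, Real.norm_eq_abs, abs_of_nonneg (hχn t)]
      exact mul_le_of_le_one_left (norm_nonneg _) (hχl t)
    have hcΦ := hΦ.continuous
    have i1 : Integrable (fun x => b1 (N x) • Φ x) ν :=
      Integrable.of_bound ((hb1.comp hN).aestronglyMeasurable.smul hcΦ.aestronglyMeasurable)
        (C * K) (Filter.Eventually.of_forall fun x => by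
          rw [norm_smul]
          gcongr
          · exact (norm_nonneg _).trans (hb1b 0)
          · exact hb1b _
          · exact hK _)
    have i2 : Integrable (fun x => w (N x) • Φ x) ν := by
      apply Integrable.restrict
      refine Continuous.integrable_of_hasCompactSupport ?_ (radial_compact (Q := Q) _ ?_)
      · fun_prop
      · intro x hx; simp [N, hw0 _ hx]
    have : ∫ x, b1 (N x) • Φ x ∂ν = ∫ x, (b1 (N x) - w (N x)) • Φ x ∂ν := by
      simp_rw [sub_smul]
      rw [integral_sub i1 i2, hA', sub_zero]
    rw [this]
    have hin : Integrable (fun t => ‖b1 t - g t‖) μ := (hb1i.sub hgi).norm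
    calc ‖∫ x, (b1 (N x) - w (N x)) • Φ x ∂ν‖
        ≤ ∫ x, ‖b1 (N x) - g (N x)‖ * K ∂ν := by
          apply norm_integral_le_of_norm_le
          · exact (hin.comp_measurable hN).mul_const K
          · refine Filter.Eventually.of_forall fun x => ?_
            rw [norm_smul]
            exact mul_le_mul (hdiff _) (hK _) (norm_nonneg _) (norm_nonneg _)
      _ = (∫ t, ‖b1 t - g t‖ ∂μ) * K := by
          rw [integral_mul_const, integral_map hN.aemeasurable hin.aestronglyMeasurable]
      _ ≤ ε * K := by gcongr
  have : ‖∫ x, b1 (N x) • Φ x ∂ν‖ ≤ 0 := by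
    apply le_of_forall_pos_le_add
    intro ε hε
    have := hest (ε / (K + 1)) (by positivity)
    refine this.trans ?_
    rw [zero_add, div_mul_eq_mul_div, div_le_iff₀ (by positivity)]
    nlinarith
  exact norm_le_zero_iff.1 this

lemma radial_rep (hd : 1 ≤ d) {β : EuclideanSpace ℝ (Fin d) → ℝ}
    (hβrot : ∀ (O : EuclideanSpace ℝ (Fin d) ≃ₗᵢ[ℝ] EuclideanSpace ℝ (Fin d))
      (Y : EuclideanSpace ℝ (Fin d)), β (O Y) = β Y) (Y : EuclideanSpace ℝ (Fin d)) :
    β Y = β (Real.sqrt (‖Y‖ ^ 2) • EuclideanSpace.single (⟨0, hd⟩ : Fin d) (1 : ℝ)) := by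
  have h : ‖Y‖ = ‖Real.sqrt (‖Y‖ ^ 2) • EuclideanSpace.single (⟨0, hd⟩ : Fin d) (1 : ℝ)‖ := by
    rw [norm_smul]; simp
  rw [← hβrot (Submodule.reflection (Submodule.span ℝ {Y -
    (Real.sqrt (‖Y‖ ^ 2) • EuclideanSpace.single (⟨0, hd⟩ : Fin d) (1 : ℝ))})ᗮ) Y,
    Submodule.reflection_sub h]

/-- the exponential eigenfunction -/
noncomputable def expo (hd : 1 ≤ d) (s : ℂ) (Y : EuclideanSpace ℝ (Fin d)) : ℂ :=
  Complex.exp (s * (Y ⟨0, hd⟩ : ℝ))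

/-- first coordinate -/
noncomputable def pr (hd : 1 ≤ d) : EuclideanSpace ℝ (Fin d) →L[ℝ] ℝ :=
  EuclideanSpace.proj (⟨0, hd⟩ : Fin d)

lemma pr_apply (hd : 1 ≤ d) (Y : EuclideanSpace ℝ (Fin d)) : pr hd Y = Y ⟨0, hd⟩ := rfl

lemma expo_contDiff (hd : 1 ≤ d) (s : ℂ) {n : WithTop ℕ∞} :
    ContDiff ℝ n (expo hd s) := by
  unfold expo
  have h : ContDiff ℝ n (fun Y : EuclideanSpace ℝ (Fin d) => ((Y ⟨0, hd⟩ : ℝ) : ℂ)) :=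
    (Complex.ofRealCLM ∘L pr hd).contDiff
  exact (contDiff_const.mul h).cexp

lemma expo_hasFDerivAt (hd : 1 ≤ d) (s : ℂ) (Y : EuclideanSpace ℝ (Fin d)) :
    HasFDerivAt (expo hd s) (expo hd s Y • s • (Complex.ofRealCLM ∘L
      pr hd)) Y := by
  have h := (Complex.ofRealCLM ∘L pr hd).hasFDerivAt (x := Y)
  exact (h.const_mul s).cexp

lemma expo_laplacian (hd : 1 ≤ d) (s : ℂ) (Y : EuclideanSpace ℝ (Fin d)) :
    euclLaplacian (expo hd s) Y = s ^ 2 * expo hd s Y := by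
  unfold euclLaplacian
  have h1 : fderiv ℝ (expo hd s) = fun Y => expo hd s Y • s • (Complex.ofRealCLM ∘L
      pr hd) :=
    funext fun Y => (expo_hasFDerivAt hd s Y).fderiv
  have h2 := ((expo_hasFDerivAt hd s Y).smul_const (s • (Complex.ofRealCLM ∘L
      pr hd))).fderiv
  simp_rw [iteratedFDeriv_two_apply, h1, h2]
  rw [Finset.sum_eq_single (⟨0, hd⟩ : Fin d)]
  · simp [pr_apply]; ring
  · intro i _ hi
    simp [pr_apply, hi.symm]
  · simp

end EigBall

open EigBall in
/-- Lemma 5 of Hall–Mitchell: if `Ψ` is smooth on the ball `B(0,R₀)` in `ℝ^d` with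
`ΔΨ = σΨ` and `β` is a bounded measurable rotationally invariant function on the ball,
then for all `R < R₀`,
`∫_{|Y|≤R} Ψ(Y)β(Y) dY = Ψ(0) ∫_{|Y|≤R} e^{√σ y₁} β(Y) dY`,
where `√σ` is either square root of `σ` in `ℂ`. -/
theorem eigenfunction_ball_integral (d : ℕ) (hd : 1 ≤ d) (R₀ : ℝ) (hR₀ : 0 < R₀)
    (Ψ : EuclideanSpace ℝ (Fin d) → ℂ) (σ : ℝ) (s : ℂ) (hs : s ^ 2 = (σ : ℂ))
    (hΨ : ContDiffOn ℝ (⊤ : ℕ∞) Ψ (ball (0 : EuclideanSpace ℝ (Fin d)) R₀))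
    (heig : ∀ x ∈ ball (0 : EuclideanSpace ℝ (Fin d)) R₀, euclLaplacian Ψ x = (σ : ℂ) * Ψ x)
    (β : EuclideanSpace ℝ (Fin d) → ℝ) (hβm : Measurable β)
    (hβb : ∃ C, ∀ Y, |β Y| ≤ C)
    (hβrot : ∀ (O : EuclideanSpace ℝ (Fin d) ≃ₗᵢ[ℝ] EuclideanSpace ℝ (Fin d))
      (Y : EuclideanSpace ℝ (Fin d)), β (O Y) = β Y)
    (R : ℝ) (hR : 0 < R) (hRR₀ : R < R₀) :
    ∫ Y in closedBall (0 : EuclideanSpace ℝ (Fin d)) R, Ψ Y * (β Y : ℂ)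
      = Ψ 0 * ∫ Y in closedBall (0 : EuclideanSpace ℝ (Fin d)) R,
          Complex.exp (s * (Y ⟨0, hd⟩ : ℝ)) * (β Y : ℂ) := by
  obtain ⟨C, hC⟩ := hβb
  set f : EuclideanSpace ℝ (Fin d) → ℂ := Ψ - Ψ 0 • expo hd s with hf
  have hfc : ContDiffOn ℝ (⊤ : ℕ∞) f (ball (0 : EuclideanSpace ℝ (Fin d)) R₀) :=
    hΨ.sub ((expo_contDiff hd s).const_smul (Ψ 0)).contDiffOn
  have hflap : ∀ x ∈ ball (0 : EuclideanSpace ℝ (Fin d)) R₀,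
      euclLaplacian f x = (σ : ℂ) * f x := by
    intro x hx
    have c1 : ContDiffAt ℝ (2 : ℕ) Ψ x :=
      (hΨ.contDiffAt (isOpen_ball.mem_nhds hx)).of_le (by exact WithTop.coe_le_coe.2 le_top)
    have c2 : ContDiffAt ℝ (2 : ℕ) (expo hd s) x := (expo_contDiff hd s).contDiffAt
    have e : euclLaplacian f x = euclLaplacian Ψ x - Ψ 0 * euclLaplacian (expo hd s) x := by
      unfold euclLaplacian
      have c3 : ContDiffAt ℝ (2 : ℕ) (Ψ 0 • expo hd s) x := c2.const_smul (Ψ 0)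
      rw [hf, iteratedFDeriv_sub_apply c1 c3,
        iteratedFDeriv_const_smul_apply c2, Finset.mul_sum, ← Finset.sum_sub_distrib]
      rfl
    rw [e, heig x hx, expo_laplacian, hs, hf]
    simp only [Pi.sub_apply, Pi.smul_apply, smul_eq_mul]
    ring
  have hf0 : f 0 = 0 := by simp [hf, expo]
  -- cutoff
  let R₁ := (R + R₀) / 2
  let R₂ := (R₁ + R₀) / 2
  have h1 : R < R₁ := by simp only [R₁]; linarith
  have h1' : R₁ < R₀ := by simp only [R₁]; linarith
  have h2 : R₁ < R₂ := by simp only [R₂]; linarith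
  have h3 : R₂ < R₀ := by simp only [R₂]; linarith
  let χ : ContDiffBump (0 : EuclideanSpace ℝ (Fin d)) := ⟨R₁, R₂, hR.trans h1, h2⟩
  let Φ : EuclideanSpace ℝ (Fin d) → ℂ := fun x => χ x • f x
  have hΦc : HasCompactSupport Φ := χ.hasCompactSupport.smul_right
  have hΦ : ContDiff ℝ 2 Φ := by
    rw [contDiff_iff_contDiffAt]
    intro x
    by_cases hx : x ∈ ball (0 : EuclideanSpace ℝ (Fin d)) R₀
    · exact χ.contDiff.contDiffAt.smul
        ((hfc.contDiffAt (isOpen_ball.mem_nhds hx)).of_le (by exact WithTop.coe_le_coe.2 le_top))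
    · have : Φ =ᶠ[nhds x] fun _ => 0 := by
        have hx' : x ∈ (closedBall (0 : EuclideanSpace ℝ (Fin d)) R₂)ᶜ := by
          simp only [mem_ball_zero_iff, not_lt, Set.mem_compl_iff, mem_closedBall_zero_iff,
            not_le] at hx ⊢
          linarith
        filter_upwards [isClosed_closedBall.isOpen_compl.mem_nhds hx'] with y hy
        have : χ y = 0 := by
          apply χ.zero_of_le_dist
          simp only [Set.mem_compl_iff, mem_closedBall, not_le] at hy
          exact hy.le
        simp [Φ, this]
      exact contDiffAt_const.congr_of_eventuallyEq this
  have hΦeq : ∀ x ∈ closedBall (0 : EuclideanSpace ℝ (Fin d)) R₁, Φ x = f x := by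
    intro x hx
    simp [Φ, χ.one_of_mem_closedBall hx]
  have hΦeig : ∀ x, ‖x‖ ^ 2 < R₁ ^ 2 → euclLaplacian Φ x = (σ : ℂ) * Φ x := by
    intro x hx
    have hxn : ‖x‖ < R₁ := lt_of_pow_lt_pow_left₀ 2 (hR.trans h1).le hx
    have hxb : x ∈ ball (0 : EuclideanSpace ℝ (Fin d)) R₁ := by simpa using hxn
    have hev : Φ =ᶠ[nhds x] f := by
      filter_upwards [isOpen_ball.mem_nhds hxb] with y hy
      exact hΦeq y (ball_subset_closedBall hy)
    have : euclLaplacian Φ x = euclLaplacian f x := by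
      unfold euclLaplacian
      rw [(Filter.EventuallyEq.iteratedFDeriv (𝕜 := ℝ) hev 2).eq_of_nhds]
    rw [this, hflap x (ball_subset_ball h1'.le hxb), hΦeq x (ball_subset_closedBall hxb)]
  have hΦ0 : Φ 0 = 0 := by simp [Φ, hf0]
  let b : ℝ → ℝ := fun t =>
    β (Real.sqrt t • EuclideanSpace.single (⟨0, hd⟩ : Fin d) (1 : ℝ))
  have hb : Measurable b := by
    apply hβm.comp
    apply Continuous.measurable
    fun_prop
  have key := measurable_radial hR (by gcongr : R ^ 2 < R₁ ^ 2) hΦ hΦc hΦeig hΦ0 hb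
    (C := C) (fun t => hC _)
  have hbY : ∀ Y : EuclideanSpace ℝ (Fin d), b (‖Y‖ ^ 2) = β Y := fun Y =>
    (radial_rep hd hβrot Y).symm
  have hint : ∀ g : EuclideanSpace ℝ (Fin d) → ℂ,
      ContinuousOn g (closedBall (0 : EuclideanSpace ℝ (Fin d)) R) →
      IntegrableOn (fun Y => g Y * (β Y : ℂ)) (closedBall 0 R) := by
    intro g hg
    refine (hg.integrableOn_compact (isCompact_closedBall _ _)).mul_bdd (c := C) ?_ ?_
    · exact (Complex.measurable_ofReal.comp hβm).aestronglyMeasurable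
    · exact Filter.Eventually.of_forall fun Y => by simpa using hC Y
  have i1 := hint Ψ (hΨ.continuousOn.mono (closedBall_subset_ball hRR₀))
  have i2 := hint (expo hd s) (expo_contDiff (n := 0) hd s).continuous.continuousOn
  have hcongr : ∫ Y in closedBall (0 : EuclideanSpace ℝ (Fin d)) R, b (‖Y‖ ^ 2) • Φ Y
      = ∫ Y in closedBall (0 : EuclideanSpace ℝ (Fin d)) R,
        (Ψ Y * (β Y : ℂ) - Ψ 0 * (expo hd s Y * (β Y : ℂ))) := by
    refine setIntegral_congr_fun measurableSet_closedBall fun Y hY => ?_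
    rw [hbY, hΦeq Y (closedBall_subset_closedBall h1.le hY), hf]
    simp only [Pi.sub_apply, Pi.smul_apply, smul_eq_mul, Complex.real_smul]
    ring
  rw [hcongr, integral_sub i1 (i2.const_mul _), integral_const_mul, sub_eq_zero] at key
  exact key
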